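/- Let G be the parallel composition of multigraphs G1 and G2 at distinct vertices a and b, let s ∈ V1 \ {a, b}, and let r_a, r_s, r_b ∈ ℤ with r_a + r_s + r_b = 0. Then mincost(G, [a ↦ r_a, s ↦ r_s, b ↦ r_b]) = ⨅_{r ∈ ℤ} ( mincost(G1, [a ↦ r, s ↦ r_s, b ↦ −r − r_s]) + mincost(G2, [a ↦ r_a − r, b ↦ r_b + r + r_s]) ), where the infimum and addition are in ℕ∞. -/

import Mathlib

open scoped BigOperators

/-- An undirected multigraph on vertex type `V` with edge type `E`:
each edge has a reference orientation `src e → tgt e`, a cost `c e` and a capacity `u e`. -/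
structure Multigraph (V E : Type) where
  src : E → V
  tgt : E → V
  c : E → ℕ
  u : E → ℕ

variable {V E : Type}

/-- The residue of a flow assignment `f : E → ℤ` at a vertex `v`:
inflow (w.r.t. the reference orientation) minus outflow. -/
def Multigraph.residue [Fintype E] [DecidableEq V] (G : Multigraph V E)
    (f : E → ℤ) (v : V) : ℤ :=
  (∑ e : E, if G.tgt e = v then f e else 0) - (∑ e : E, if G.src e = v then f e else 0)

/-- `f` is an `r`-circulation supported on `F`: it vanishes outside `F`,
respects capacities, and has residue `r v` at every vertex `v`. -/
def Multigraph.IsCirculation [Fintype E] [DecidableEq V] (G : Multigraph V E)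
    (r : V → ℤ) (F : Finset E) (f : E → ℤ) : Prop :=
  (∀ e, e ∉ F → f e = 0) ∧ (∀ e, |f e| ≤ (G.u e : ℤ)) ∧ (∀ v, G.residue f v = r v)

/-- The minimum cost (in `ℕ∞`) of a subset `F` of the allowed edge set `E'`
admitting an `r`-circulation supported on `F`.  Taking `E' = Finset.univ`
gives `mincost(G, r)`; taking `E' = E₁` for a sub-multigraph `(V₁, E₁)` all of
whose edges have both endpoints in `V₁` gives `mincost(G₁, r)` whenever `r`
vanishes outside `V₁`. -/
noncomputable def Multigraph.mincostOn [Fintype E] [DecidableEq V] (G : Multigraph V E)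
    (E' : Finset E) (r : V → ℤ) : ℕ∞ :=
  ⨅ (F : Finset E) (_ : F ⊆ E' ∧ ∃ f : E → ℤ, G.IsCirculation r F f),
    ((∑ e ∈ F, G.c e : ℕ) : ℕ∞)

namespace Multigraph

section Residue

variable [Fintype E] [DecidableEq V] (G : Multigraph V E)

theorem residue_add (f g : E → ℤ) (v : V) :
    G.residue (fun e => f e + g e) v = G.residue f v + G.residue g v := by
  have key (p : E → Prop) [DecidablePred p] :
      (∑ e, if p e then f e + g e else 0) =
        (∑ e, if p e then f e else 0) + ∑ e, if p e then g e else 0 := by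
    rw [← Finset.sum_add_distrib]
    exact Finset.sum_congr rfl fun e _ => by split_ifs <;> simp
  simp only [residue, key]
  ring

theorem sum_residue [Fintype V] (f : E → ℤ) : ∑ v, G.residue f v = 0 := by
  simp only [residue, Finset.sum_sub_distrib]
  rw [Finset.sum_comm, Finset.sum_comm (f := fun v e => if G.src e = v then f e else 0)]
  simp

/-- A flow carried by edges inside `W` has zero residue outside `W`. -/
theorem residue_eq_zero_of_notMem {W : Finset V} {F : Finset E} {f : E → ℤ}
    (hF : ∀ e ∈ F, G.src e ∈ W ∧ G.tgt e ∈ W) (hf : ∀ e, e ∉ F → f e = 0)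
    {v : V} (hv : v ∉ W) : G.residue f v = 0 := by
  have hsrc : ∀ e, (if G.src e = v then f e else 0) = 0 := fun e => by
    split_ifs with h
    · exact hf e fun he => hv (h ▸ (hF e he).1)
    · rfl
  have htgt : ∀ e, (if G.tgt e = v then f e else 0) = 0 := fun e => by
    split_ifs with h
    · exact hf e fun he => hv (h ▸ (hF e he).2)
    · rfl
  simp [residue, hsrc, htgt]

end Residue

section Mincost

variable [Fintype E] [DecidableEq V] {G : Multigraph V E}

theorem IsCirculation.mincostOn_le {r : V → ℤ} {E' F : Finset E} {f : E → ℤ}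
    (h : G.IsCirculation r F f) (hF : F ⊆ E') :
    G.mincostOn E' r ≤ ((∑ e ∈ F, G.c e : ℕ) : ℕ∞) :=
  iInf₂_le F ⟨hF, f, h⟩

/-- A finite minimum cost is attained. -/
theorem exists_isCirculation_of_mincostOn_ne_top {r : V → ℤ} {E' : Finset E}
    (h : G.mincostOn E' r ≠ ⊤) :
    ∃ F ⊆ E', ∃ f, G.IsCirculation r F f ∧
      G.mincostOn E' r = ((∑ e ∈ F, G.c e : ℕ) : ℕ∞) := by
  rw [mincostOn, iInf_subtype'] at h ⊢
  have : Nonempty {F : Finset E // F ⊆ E' ∧ ∃ f : E → ℤ, G.IsCirculation r F f} := by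
    by_contra hempty
    rw [not_nonempty_iff] at hempty
    exact h (iInf_of_empty _)
  obtain ⟨⟨F, hF, f, hf⟩, heq⟩ := ciInf_mem
    fun F : {F : Finset E // F ⊆ E' ∧ ∃ f : E → ℤ, G.IsCirculation r F f} =>
      ((∑ e ∈ F.1, G.c e : ℕ) : ℕ∞)
  exact ⟨F, hF, f, hf, heq.symm⟩

variable [DecidableEq E]

/-- Circulations on disjoint edge sets can be superimposed. -/
theorem IsCirculation.add {r₁ r₂ : V → ℤ} {F₁ F₂ : Finset E} {f₁ f₂ : E → ℤ}
    (h₁ : G.IsCirculation r₁ F₁ f₁) (h₂ : G.IsCirculation r₂ F₂ f₂) (hd : Disjoint F₁ F₂) :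
    G.IsCirculation (fun v => r₁ v + r₂ v) (F₁ ∪ F₂) (fun e => f₁ e + f₂ e) := by
  refine ⟨fun e he => ?_, fun e => ?_, fun v => ?_⟩
  · rw [Finset.mem_union, not_or] at he
    simp [h₁.1 e he.1, h₂.1 e he.2]
  · by_cases he : e ∈ F₁
    · simpa [h₂.1 e (Finset.disjoint_left.1 hd he)] using h₁.2.1 e
    · simpa [h₁.1 e he] using h₂.2.1 e
  · rw [residue_add, h₁.2.2, h₂.2.2]

theorem IsCirculation.restrict {r : V → ℤ} {F : Finset E} {f : E → ℤ}
    (h : G.IsCirculation r F f) (E' : Finset E) :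
    G.IsCirculation (G.residue fun e => if e ∈ E' then f e else 0) (F ∩ E')
      (fun e => if e ∈ E' then f e else 0) := by
  refine ⟨fun e he => ?_, fun e => ?_, fun v => rfl⟩
  · beta_reduce
    split_ifs with h'
    · exact h.1 e fun hF => he (Finset.mem_inter.2 ⟨hF, h'⟩)
    · rfl
  · beta_reduce
    split_ifs
    · exact h.2.1 e
    · simp

end Mincost

end Multigraph

/-- Case 2.3: parallel composition, 3-tuple of residues. -/
theorem parallel_three_tuple {V E : Type}
    [Fintype V] [Fintype E] [DecidableEq V] [DecidableEq E]
    (G : Multigraph V E) (V1 V2 : Finset V) (E1 E2 : Finset E)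
    (hE : E1 ∪ E2 = Finset.univ) (hEdisj : Disjoint E1 E2)
    (hV : V1 ∪ V2 = Finset.univ)
    (hG1 : ∀ e ∈ E1, G.src e ∈ V1 ∧ G.tgt e ∈ V1)
    (hG2 : ∀ e ∈ E2, G.src e ∈ V2 ∧ G.tgt e ∈ V2)
    (a b s : V) (hab : a ≠ b) (hVab : V1 ∩ V2 = {a, b})
    (hs : s ∈ V1) (hsa : s ≠ a) (hsb : s ≠ b)
    (ra rs rb : ℤ) (hsum : ra + rs + rb = 0) :
    G.mincostOn Finset.univ
        (fun v => if v = a then ra else if v = s then rs else if v = b then rb else 0) =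
      ⨅ r : ℤ,
        G.mincostOn E1
          (fun v => if v = a then r else if v = s then rs else if v = b then -r - rs else 0) +
        G.mincostOn E2 (fun v => if v = a then ra - r else if v = b then rb + r + rs else 0) := by
  apply le_antisymm
  · refine le_iInf fun r => ?_
    by_cases h₁ : G.mincostOn E1 (fun v => if v = a then r else if v = s then rs
        else if v = b then -r - rs else 0) = ⊤
    · rw [h₁, top_add]
      exact le_top
    by_cases h₂ : G.mincostOn E2 (fun v => if v = a then ra - r
        else if v = b then rb + r + rs else 0) = ⊤
    · rw [h₂, add_top]
      exact le_top
    obtain ⟨F₁, hF₁, f₁, hf₁, e₁⟩ := Multigraph.exists_isCirculation_of_mincostOn_ne_top h₁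
    obtain ⟨F₂, hF₂, f₂, hf₂, e₂⟩ := Multigraph.exists_isCirculation_of_mincostOn_ne_top h₂
    have hd : Disjoint F₁ F₂ := hEdisj.mono hF₁ hF₂
    rw [e₁, e₂, ← Nat.cast_add, ← Finset.sum_union hd]
    have hadd := hf₁.add hf₂ hd
    refine Multigraph.IsCirculation.mincostOn_le (f := fun e => f₁ e + f₂ e)
      ⟨hadd.1, hadd.2.1, fun v => ?_⟩ (Finset.subset_univ _)
    rw [hadd.2.2]
    grind
  · refine le_iInf₂ fun F ⟨_, f, hf⟩ => ?_
    have hr₁ := hf.restrict E1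
    have hr₂ := hf.restrict E2
    set f₁ : E → ℤ := fun e => if e ∈ E1 then f e else 0 with hf₁
    set f₂ : E → ℤ := fun e => if e ∈ E2 then f e else 0 with hf₂
    have hEmem : ∀ e, e ∈ E1 ∨ e ∈ E2 := fun e => by
      rw [← Finset.mem_union, hE]
      exact Finset.mem_univ e
    have hVmem : ∀ v, v ∈ V1 ∨ v ∈ V2 := fun v => by
      rw [← Finset.mem_union, hV]
      exact Finset.mem_univ v
    have hVab' : ∀ v, (v ∈ V1 ∧ v ∈ V2) ↔ (v = a ∨ v = b) := fun v => by
      rw [← Finset.mem_inter, hVab]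
      simp
    have hsplit : (fun e => f₁ e + f₂ e) = f := by
      funext e
      have hd : e ∈ E1 → e ∉ E2 := fun h => Finset.disjoint_left.1 hEdisj h
      rcases hEmem e with h | h <;> grind
    have hres : ∀ v, G.residue f₁ v + G.residue f₂ v =
        if v = a then ra else if v = s then rs else if v = b then rb else 0 := fun v => by
      rw [← Multigraph.residue_add, hsplit, hf.2.2]
    have hz₁ : ∀ v, v ∉ V1 → G.residue f₁ v = 0 := fun v =>
      G.residue_eq_zero_of_notMem hG1 fun e he => if_neg he
    have hz₂ : ∀ v, v ∉ V2 → G.residue f₂ v = 0 := fun v =>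
      G.residue_eq_zero_of_notMem hG2 fun e he => if_neg he
    have hs₁ : G.residue f₁ s = rs := by grind
    have hout : ∀ v, v ≠ a → v ≠ s → v ≠ b → G.residue f₁ v = 0 := fun v _ _ _ => by grind
    have htot : G.residue f₁ a + (G.residue f₁ s + G.residue f₁ b) = 0 := by
      have hsub : ∑ v ∈ {a, s, b}, G.residue f₁ v = ∑ v, G.residue f₁ v :=
        Finset.sum_subset (Finset.subset_univ _) fun v _ hv => by
          simp only [Finset.mem_insert, Finset.mem_singleton, not_or] at hv
          exact hout v hv.1 hv.2.1 hv.2.2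
      rw [G.sum_residue, Finset.sum_insert (by simp [hsa.symm, hab]),
        Finset.sum_insert (by simp [hsb]), Finset.sum_singleton] at hsub
      exact hsub
    have hcost : ∑ e ∈ F, G.c e = ∑ e ∈ F ∩ E1, G.c e + ∑ e ∈ F ∩ E2, G.c e := by
      rw [← Finset.sum_union (hEdisj.mono Finset.inter_subset_right Finset.inter_subset_right),
        ← Finset.inter_union_distrib_left, hE, Finset.inter_univ]
    rw [hcost, Nat.cast_add]
    refine (iInf_le _ (G.residue f₁ a)).trans (add_le_add ?_ ?_)
    · refine Multigraph.IsCirculation.mincostOn_le (f := f₁)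
        ⟨hr₁.1, hr₁.2.1, fun v => ?_⟩ Finset.inter_subset_right
      grind
    · refine Multigraph.IsCirculation.mincostOn_le (f := f₂)
        ⟨hr₂.1, hr₂.2.1, fun v => ?_⟩ Finset.inter_subset_right
      grind
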